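/- Let (ρ_t)_{t∈ℕ} be a time consistent dynamic convex risk measure for processes such that each ρ_t is cash additive at time t+1, i.e. ρ_t(X + m·1_{𝕋_{t+1}}) = ρ_t(X) − m P-a.s. for all X ∈ ℛ_t^∞ and all m ∈ L^∞_t. Then each ρ_t is cash additive: for every integer s ≥ 1, every X ∈ ℛ_t^∞ and every m ∈ L^∞_t, ρ_t(X + m·1_{𝕋_{t+s}}) = ρ_t(X) − m P-a.s. -/

import Mathlib

open MeasureTheory Filter

variable {Ω : Type*}

/-- Bounded measurable real-valued functions with respect to a σ-algebra (the space `L^∞`). -/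
def BddMeas {α : Type*} (mm : MeasurableSpace α) (f : α → ℝ) : Prop :=
  Measurable[mm] f ∧ ∃ C : ℝ, ∀ x, |f x| ≤ C

/-- The space `ℛ^∞` of bounded adapted processes. -/
def MemRinf {m : MeasurableSpace Ω} (F : Filtration ℕ m) (X : ℕ → Ω → ℝ) : Prop :=
  (∀ s, Measurable[F s] (X s)) ∧ ∃ C : ℝ, ∀ s ω, |X s ω| ≤ C

/-- The projection `π_t` killing a process strictly before time `t`. -/
def projt (t : ℕ) (X : ℕ → Ω → ℝ) : ℕ → Ω → ℝ := fun r ω => if t ≤ r then X r ω else 0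

/-- Membership in `ℛ_t^∞ = π_t(ℛ^∞)`: bounded adapted processes vanishing before `t`. -/
def MemRt {m : MeasurableSpace Ω} (F : Filtration ℕ m) (t : ℕ) (X : ℕ → Ω → ℝ) : Prop :=
  MemRinf F X ∧ ∀ r < t, ∀ ω, X r ω = 0

/-- A conditional convex risk measure for processes at time `t`:  a map
`ρ_t : ℛ_t^∞ → L^∞_t` which is conditionally cash invariant, monotone, conditionally
convex and normalized. -/
structure IsCondRiskMeasure {m : MeasurableSpace Ω} (F : Filtration ℕ m) (P : Measure Ω)
    (t : ℕ) (ρ : (ℕ → Ω → ℝ) → Ω → ℝ) : Prop where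
  map_into : ∀ X, MemRt F t X → BddMeas (F t) (ρ X)
  cash : ∀ X, MemRt F t X → ∀ mf : Ω → ℝ, BddMeas (F t) mf →
    ρ (fun r ω => X r ω + if t ≤ r then mf ω else 0) =ᵐ[P] fun ω => ρ X ω - mf ω
  mono : ∀ X Y, MemRt F t X → MemRt F t Y → (∀ s, ∀ᵐ ω ∂P, X s ω ≤ Y s ω) →
    ∀ᵐ ω ∂P, ρ Y ω ≤ ρ X ω
  convex : ∀ X Y, MemRt F t X → MemRt F t Y → ∀ lam : Ω → ℝ,
    Measurable[F t] lam → (∀ ω, 0 ≤ lam ω ∧ lam ω ≤ 1) →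
    ∀ᵐ ω ∂P, ρ (fun r ω => lam ω * X r ω + (1 - lam ω) * Y r ω) ω ≤
      lam ω * ρ X ω + (1 - lam ω) * ρ Y ω
  norm : ρ (fun _ _ => 0) =ᵐ[P] (0 : Ω → ℝ)

/-- Time consistency of a dynamic convex risk measure for processes. -/
def TimeConsistent {m : MeasurableSpace Ω} (F : Filtration ℕ m) (P : Measure Ω)
    (ρ : ℕ → (ℕ → Ω → ℝ) → Ω → ℝ) : Prop :=
  ∀ t (X Y : ℕ → Ω → ℝ), MemRinf F X → MemRinf F Y →
    X t =ᵐ[P] Y t →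
    (∀ᵐ ω ∂P, ρ (t + 1) (projt (t + 1) X) ω ≤ ρ (t + 1) (projt (t + 1) Y) ω) →
    ∀ᵐ ω ∂P, ρ t (projt t X) ω ≤ ρ t (projt t Y) ω

/-- The process `X_t·1_{{t}} − ρ_{t+1}(X)·1_{𝕋_{t+1}}`. -/
def oneStepTarget (ρ : ℕ → (ℕ → Ω → ℝ) → Ω → ℝ) (t : ℕ) (X : ℕ → Ω → ℝ) :
    ℕ → Ω → ℝ :=
  fun r ω => if r = t then X t ω else if t + 1 ≤ r then -ρ (t + 1) (projt (t + 1) X) ω else 0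

/-- The acceptance set `𝒜_t` of a conditional convex risk measure for processes. -/
def AcceptSet {m : MeasurableSpace Ω} (F : Filtration ℕ m) (P : Measure Ω) (t : ℕ)
    (ρ : (ℕ → Ω → ℝ) → Ω → ℝ) : Set (ℕ → Ω → ℝ) :=
  {X | MemRt F t X ∧ ∀ᵐ ω ∂P, ρ X ω ≤ 0}

/-- The one-step acceptance set `𝒜_{t,t+1}`: acceptable processes in `ℛ_{t,t+1}^∞`. -/
def AcceptSetStep {m : MeasurableSpace Ω} (F : Filtration ℕ m) (P : Measure Ω) (t : ℕ)
    (ρ : (ℕ → Ω → ℝ) → Ω → ℝ) : Set (ℕ → Ω → ℝ) :=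
  {X | MemRt F t X ∧ (∀ r, t + 1 ≤ r → X r = X (t + 1)) ∧ ∀ᵐ ω ∂P, ρ X ω ≤ 0}

theorem projt_of_memRt {Ω : Type*} {m : MeasurableSpace Ω} {F : Filtration ℕ m} {t : ℕ}
    {X : ℕ → Ω → ℝ} (hX : MemRt F t X) : projt t X = X := by
  funext r ω
  unfold projt
  split_ifs with h
  · rfl
  · exact (hX.2 r (not_le.mp h) ω).symm

theorem MemRinf.memRt_projt {Ω : Type*} {m : MeasurableSpace Ω} {F : Filtration ℕ m}
    {X : ℕ → Ω → ℝ} (hX : MemRinf F X) (t : ℕ) : MemRt F t (projt t X) := by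
  obtain ⟨hm, C, hC⟩ := hX
  refine ⟨⟨fun s => ?_, C, fun s ω => ?_⟩, fun r hr ω => if_neg (not_le.mpr hr)⟩
  · unfold projt
    split_ifs
    · exact hm s
    · exact measurable_const
  · unfold projt
    split_ifs
    · exact hC s ω
    · simpa using (abs_nonneg _).trans (hC s ω)

theorem MemRt.add_cash {Ω : Type*} {m : MeasurableSpace Ω} {F : Filtration ℕ m} {t u : ℕ}
    (htu : t ≤ u) {X : ℕ → Ω → ℝ} (hX : MemRt F t X) {mf : Ω → ℝ} (hmf : BddMeas (F t) mf) :
    MemRt F t (fun r ω => X r ω + if u ≤ r then mf ω else 0) := by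
  obtain ⟨⟨hm, C, hC⟩, h0⟩ := hX
  obtain ⟨hmm, D, hD⟩ := hmf
  refine ⟨⟨fun s => ?_, C + D, fun s ω => ?_⟩, fun r hr ω => ?_⟩
  · by_cases h : u ≤ s
    · simp only [if_pos h]
      exact (hm s).add (hmm.mono (F.mono (htu.trans h)) le_rfl)
    · simpa [h] using hm s
  · refine (abs_add_le _ _).trans (add_le_add (hC s ω) ?_)
    split_ifs
    · exact hD ω
    · simpa using (abs_nonneg _).trans (hD ω)
  · simp [h0 r hr ω, not_le.mpr (hr.trans_le htu)]

theorem projt_add_cash {Ω : Type*} {t u : ℕ} (htu : t ≤ u) (X : ℕ → Ω → ℝ) (mf : Ω → ℝ) :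
    projt t (fun r ω => X r ω + if u ≤ r then mf ω else 0) =
      fun r ω => projt t X r ω + if u ≤ r then mf ω else 0 := by
  funext r ω
  by_cases h : t ≤ r
  · simp [projt, h]
  · simp [projt, h, show ¬u ≤ r by omega]

theorem TimeConsistent.ae_eq {Ω : Type*} {m : MeasurableSpace Ω} {F : Filtration ℕ m}
    {P : Measure Ω} {ρ : ℕ → (ℕ → Ω → ℝ) → Ω → ℝ} (htc : TimeConsistent F P ρ) {t : ℕ}
    {X Y : ℕ → Ω → ℝ} (hX : MemRt F t X) (hY : MemRt F t Y) (hXY : X t =ᵐ[P] Y t)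
    (h : ρ (t + 1) (projt (t + 1) X) =ᵐ[P] ρ (t + 1) (projt (t + 1) Y)) :
    ρ t X =ᵐ[P] ρ t Y := by
  have h₁ := htc t X Y hX.1 hY.1 hXY h.le
  have h₂ := htc t Y X hY.1 hX.1 hXY.symm h.symm.le
  rw [projt_of_memRt hX, projt_of_memRt hY] at h₁ h₂
  filter_upwards [h₁, h₂] with ω a b using le_antisymm a b

/-- **Time consistency propagates one-step cash additivity to full cash additivity.**
If a time consistent dynamic convex risk measure for processes satisfies
`ρ_t(X + m·1_{𝕋_{t+1}}) = ρ_t(X) − m` a.s. for all `t`, `X ∈ ℛ_t^∞`, `m ∈ L^∞_t`,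
then `ρ_t(X + m·1_{𝕋_{t+s}}) = ρ_t(X) − m` a.s. for every `s ≥ 1`. -/
theorem stmt_13 {Ω : Type*} {m : MeasurableSpace Ω} (F : Filtration ℕ m)
    (P : Measure Ω) [IsProbabilityMeasure P]
    (hF0 : ∀ A : Set Ω, MeasurableSet[F 0] A → P A = 0 ∨ P A = 1)
    (ρ : ℕ → (ℕ → Ω → ℝ) → Ω → ℝ)
    (hρ : ∀ t, IsCondRiskMeasure F P t (ρ t))
    (htc : TimeConsistent F P ρ)
    (hca1 : ∀ t, ∀ X : ℕ → Ω → ℝ, MemRt F t X → ∀ mf : Ω → ℝ, BddMeas (F t) mf →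
      ρ t (fun r ω => X r ω + if t + 1 ≤ r then mf ω else 0) =ᵐ[P]
        fun ω => ρ t X ω - mf ω) :
    ∀ t, ∀ s : ℕ, 1 ≤ s → ∀ X : ℕ → Ω → ℝ, MemRt F t X →
      ∀ mf : Ω → ℝ, BddMeas (F t) mf →
        ρ t (fun r ω => X r ω + if t + s ≤ r then mf ω else 0) =ᵐ[P]
          fun ω => ρ t X ω - mf ω := by
  intro t s hs
  induction s, hs using Nat.le_induction generalizing t with
  | base => exact hca1 t
  | succ s hs ih =>
    intro X hX mf hmf
    have hmf' : BddMeas (F (t + 1)) mf := ⟨hmf.1.mono (F.mono t.le_succ) le_rfl, hmf.2⟩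
    have hX' := hX.1.memRt_projt (t + 1)
    refine (htc.ae_eq (hX.add_cash (by omega) hmf) (hX.add_cash t.le_succ hmf) ?_ ?_).trans
      (hca1 t X hX mf hmf)
    · simp
    · rw [projt_add_cash (by omega), projt_add_cash le_rfl]
      have h := ih (t + 1) _ hX' mf hmf'
      rw [show t + 1 + s = t + (s + 1) by omega] at h
      exact h.trans ((hρ (t + 1)).cash _ hX' mf hmf').symm
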